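/- Let Γ be an infinite finitely generated subgroup of GL_m(ℂ) for some m, let X be a finite generating set of Γ, and let k be a positive natural number. Then F_{Γ,X} ≈ F^k_{Γ,X}. (Lemma 2.1, a consequence of Selberg's Lemma.) -/

import Mathlib

open scoped Pointwise

section FarbDefs

variable {G : Type*} [Group G]

/-- Word length of `g` with respect to a generating set `X` (symmetrized). -/
noncomputable def wordLength (X : Set G) (g : G) : ℕ :=
  sInf {n | ∃ l : List G, l.length = n ∧ (∀ x ∈ l, x ∈ X ∨ x⁻¹ ∈ X) ∧ l.prod = g}

/-- `farbD g` is the minimal cardinality of a finite quotient of `G` detecting `g`. -/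
noncomputable def farbD (g : G) : ℕ :=
  sInf {k | ∃ N : Subgroup G, N.Normal ∧ N.FiniteIndex ∧ g ∉ N ∧ N.index = k}

/-- The normal Farb growth function of `G` with respect to `X`. -/
noncomputable def farbF (X : Set G) (n : ℕ) : ℕ :=
  sSup {d | ∃ g : G, g ≠ 1 ∧ wordLength X g ≤ n ∧ farbD g = d}

/-- The auxiliary function `F^k`. -/
noncomputable def farbFk (k : ℕ) (X : Set G) (n : ℕ) : ℕ :=
  sSup {d | ∃ g : G, g ^ k ≠ 1 ∧ wordLength X g ≤ n ∧ farbD (g ^ k) = d}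

/-- `f ≼ g` : there is `M` with `f n ≤ M * g (M * n)` for all `n`. -/
def FarbPreceq (f g : ℕ → ℕ) : Prop := ∃ M : ℕ, 0 < M ∧ ∀ n, f n ≤ M * g (M * n)

/-- `f ≈ g`. -/
def FarbEquiv (f g : ℕ → ℕ) : Prop := FarbPreceq f g ∧ FarbPreceq g f

/-- A group is residually finite if every nontrivial element is detected by a
finite quotient. -/
def ResiduallyFinite (G : Type*) [Group G] : Prop :=
  ∀ g : G, g ≠ 1 → ∃ N : Subgroup G, N.Normal ∧ N.FiniteIndex ∧ g ∉ N

end FarbDefs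

section WordLength

variable {G : Type*} [Group G] {X : Set G}

theorem exists_list_length_eq_wordLength (hX : Subgroup.closure X = ⊤) (g : G) :
    ∃ l : List G, l.length = wordLength X g ∧ (∀ x ∈ l, x ∈ X ∨ x⁻¹ ∈ X) ∧ l.prod = g := by
  have hne : {n | ∃ l : List G, l.length = n ∧ (∀ x ∈ l, x ∈ X ∨ x⁻¹ ∈ X) ∧
      l.prod = g}.Nonempty := by
    have hg : g ∈ (Subgroup.closure X).toSubmonoid := by simp [hX]
    rw [Subgroup.closure_toSubmonoid] at hg
    obtain ⟨l, hl, hprod⟩ := Submonoid.exists_list_of_mem_closure hg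
    exact ⟨l.length, l, rfl, fun x hx => by simpa using hl x hx, hprod⟩
  exact Nat.sInf_mem hne

theorem wordLength_prod_le {l : List G} (hl : ∀ x ∈ l, x ∈ X ∨ x⁻¹ ∈ X) :
    wordLength X l.prod ≤ l.length :=
  Nat.sInf_le ⟨l, rfl, hl, rfl⟩

theorem wordLength_pow_le (hX : Subgroup.closure X = ⊤) (g : G) (k : ℕ) :
    wordLength X (g ^ k) ≤ k * wordLength X g := by
  obtain ⟨l, hlen, hl, hprod⟩ := exists_list_length_eq_wordLength hX g
  have h : ∀ x ∈ (List.replicate k l).flatten, x ∈ X ∨ x⁻¹ ∈ X := by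
    intro x hx
    obtain ⟨l', hl', hx'⟩ := List.mem_flatten.mp hx
    rw [List.eq_of_mem_replicate hl'] at hx'
    exact hl x hx'
  simpa [List.prod_flatten, hprod, hlen] using wordLength_prod_le h

theorem eq_one_of_wordLength_eq_zero (hX : Subgroup.closure X = ⊤) {g : G}
    (hg : wordLength X g = 0) : g = 1 := by
  obtain ⟨l, hlen, -, hprod⟩ := exists_list_length_eq_wordLength hX g
  rw [hg, List.length_eq_zero_iff] at hlen
  simpa [hlen] using hprod.symm

theorem finite_wordLength_le (hX : Subgroup.closure X = ⊤) (hfin : X.Finite) (n : ℕ) :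
    {g : G | wordLength X g ≤ n}.Finite := by
  have : Finite ↥(X ∪ X⁻¹) := (hfin.union hfin.inv).to_subtype
  refine ((List.finite_length_le ↥(X ∪ X⁻¹) n).image
    fun l => (l.map Subtype.val).prod).subset ?_
  intro g hg
  obtain ⟨l, hlen, hl, hprod⟩ := exists_list_length_eq_wordLength hX g
  refine ⟨l.attachWith (· ∈ X ∪ X⁻¹) fun x hx => by simpa using hl x hx, ?_, ?_⟩
  · simpa [hlen] using hg
  · simpa using hprod

end WordLength

section FarbD

variable {G : Type*} [Group G]

theorem farbD_le_index {g : G} {N : Subgroup G} (hN : N.Normal) (hfin : N.FiniteIndex)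
    (hg : g ∉ N) : farbD g ≤ N.index :=
  Nat.sInf_le ⟨N, hN, hfin, hg, rfl⟩

theorem ResiduallyFinite.exists_index_eq_farbD (hG : ResiduallyFinite G) {g : G} (hg : g ≠ 1) :
    ∃ N : Subgroup G, N.Normal ∧ N.FiniteIndex ∧ g ∉ N ∧ N.index = farbD g := by
  obtain ⟨N, hN, hfin, hgN⟩ := hG g hg
  exact Nat.sInf_mem (s := {k | ∃ N : Subgroup G, N.Normal ∧ N.FiniteIndex ∧ g ∉ N ∧
    N.index = k}) ⟨N.index, N, hN, hfin, hgN, rfl⟩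

theorem ResiduallyFinite.farbD_pos (hG : ResiduallyFinite G) {g : G} (hg : g ≠ 1) :
    0 < farbD g := by
  obtain ⟨N, -, hfin, -, hN⟩ := hG.exists_index_eq_farbD hg
  exact hN ▸ Nat.pos_of_ne_zero hfin.index_ne_zero

theorem ResiduallyFinite.farbD_le_farbD_pow (hG : ResiduallyFinite G) {g : G} {k : ℕ}
    (hg : g ^ k ≠ 1) : farbD g ≤ farbD (g ^ k) := by
  obtain ⟨N, hN, hfin, hgN, hidx⟩ := hG.exists_index_eq_farbD hg
  exact hidx ▸ farbD_le_index hN hfin fun h => hgN (N.pow_mem h k)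

variable {X : Set G}

theorem farbD_le_farbF (hX : Subgroup.closure X = ⊤) (hfin : X.Finite) {g : G} (hg : g ≠ 1)
    {n : ℕ} (hn : wordLength X g ≤ n) : farbD g ≤ farbF X n := by
  refine le_csSup (((finite_wordLength_le hX hfin n).image farbD).subset ?_).bddAbove
    ⟨g, hg, hn, rfl⟩
  rintro _ ⟨g, -, hg, rfl⟩
  exact ⟨g, hg, rfl⟩

theorem farbD_pow_le_farbFk (hX : Subgroup.closure X = ⊤) (hfin : X.Finite) {g : G} {k : ℕ}
    (hg : g ^ k ≠ 1) {n : ℕ} (hn : wordLength X g ≤ n) : farbD (g ^ k) ≤ farbFk k X n := by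
  refine le_csSup (((finite_wordLength_le hX hfin n).image fun g => farbD (g ^ k)).subset
    ?_).bddAbove ⟨g, hg, hn, rfl⟩
  rintro _ ⟨g, -, hg, rfl⟩
  exact ⟨g, hg, rfl⟩

theorem farbF_le {n b : ℕ} (h : ∀ g : G, g ≠ 1 → wordLength X g ≤ n → farbD g ≤ b) :
    farbF X n ≤ b := by
  refine csSup_le' ?_
  rintro _ ⟨g, hg, hn, rfl⟩
  exact h g hg hn

theorem farbFk_le {k n b : ℕ}
    (h : ∀ g : G, g ^ k ≠ 1 → wordLength X g ≤ n → farbD (g ^ k) ≤ b) :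
    farbFk k X n ≤ b := by
  refine csSup_le' ?_
  rintro _ ⟨g, hg, hn, rfl⟩
  exact h g hg hn

theorem farbFk_preceq_farbF (hX : Subgroup.closure X = ⊤) (hfin : X.Finite) {k : ℕ}
    (hk : 0 < k) : FarbPreceq (farbFk k X) (farbF X) := by
  refine ⟨k, hk, fun n => farbFk_le fun g hg hn => ?_⟩
  exact (farbD_le_farbF hX hfin hg ((wordLength_pow_le hX g k).trans
    (Nat.mul_le_mul_left k hn))).trans (Nat.le_mul_of_pos_left _ hk)

/-- If a finite index normal subgroup contains no nontrivial element of exponent `k`, then the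
normal Farb growth function is dominated by its restriction to `k`-th powers. -/
theorem farbF_preceq_farbFk [Infinite G] (hG : ResiduallyFinite G)
    (hX : Subgroup.closure X = ⊤) (hfin : X.Finite) {k : ℕ} {N : Subgroup G} (hN : N.Normal)
    (hNfin : N.FiniteIndex) (htors : ∀ g ∈ N, g ^ k = 1 → g = 1) :
    FarbPreceq (farbF X) (farbFk k X) := by
  obtain ⟨h, hh⟩ : ∃ h : G, h ^ k ≠ 1 := by
    by_contra! hall
    have hbot : N = ⊥ := (Subgroup.eq_bot_iff_forall N).mpr fun g hg => htors g hg (hall g)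
    have hcard : Nat.card G ≠ 0 := by
      rw [← Subgroup.index_bot, ← hbot]
      exact hNfin.index_ne_zero
    exact hcard Nat.card_eq_zero_of_infinite
  set M := max N.index (wordLength X h) with hM
  have hMpos : 0 < M := lt_max_of_lt_left (Nat.pos_of_ne_zero hNfin.index_ne_zero)
  refine ⟨M, hMpos, fun n => farbF_le fun g hg hn => ?_⟩
  by_cases hgk : g ^ k = 1
  · have hn0 : 0 < n := Nat.pos_of_ne_zero fun h0 =>
      hg (eq_one_of_wordLength_eq_zero hX (by omega))
    have hpos : 0 < farbFk k X (M * n) :=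
      (hG.farbD_pos hh).trans_le (farbD_pow_le_farbFk hX hfin hh
        ((le_max_right _ _).trans (Nat.le_mul_of_pos_right M hn0)))
    calc farbD g ≤ N.index := farbD_le_index hN hNfin fun hgN => hg (htors g hgN hgk)
      _ ≤ M := le_max_left _ _
      _ ≤ M * farbFk k X (M * n) := Nat.le_mul_of_pos_right M hpos
  · calc farbD g ≤ farbD (g ^ k) := hG.farbD_le_farbD_pow hgk
      _ ≤ farbFk k X (M * n) :=
        farbD_pow_le_farbFk hX hfin hgk (hn.trans (Nat.le_mul_of_pos_left n hMpos))
      _ ≤ M * farbFk k X (M * n) := Nat.le_mul_of_pos_left _ hMpos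

end FarbD

section FiniteType

theorem isJacobsonRing_int : IsJacobsonRing ℤ := by
  rw [isJacobsonRing_iff_prime_eq]
  intro P hP
  by_cases hbot : P = ⊥
  · subst hbot
    refine le_antisymm (fun x hx => ?_) Ideal.le_jacobson
    have hu := Ideal.mem_jacobson_bot.mp hx x
    rw [Int.isUnit_iff] at hu
    rw [Ideal.mem_bot]
    rcases hu with hu | hu <;> nlinarith [mul_self_nonneg x]
  · have := hP.isMaximal hbot
    exact Ideal.jacobson_eq_self_of_isMaximal

theorem finite_of_finiteType_int (K : Type*) [Field K] [inst : Algebra ℤ K]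
    [Algebra.FiniteType ℤ K] : Finite K := by
  obtain rfl : inst = Ring.toIntAlgebra K := Subsingleton.elim _ _
  have := isJacobsonRing_int
  have hfin : Module.Finite ℤ K := finite_of_finite_type_of_isJacobsonRing ℤ K
  obtain ⟨p, hp⟩ := CharP.exists K
  rcases Nat.eq_zero_or_pos p with rfl | hpos
  · have := CharP.charP_to_charZero K
    exact absurd (isField_of_isIntegral_of_isField
      (FaithfulSMul.algebraMap_injective ℤ K) (Field.toIsField K)) Int.not_isField
  · have : NeZero p := ⟨hpos.ne'⟩
    let := ZMod.algebra K p
    have : Module.Finite (ZMod p) K := Module.Finite.of_restrictScalars_finite ℤ (ZMod p) K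
    exact Module.finite_of_finite (ZMod p)

/-- In a domain of finite type over `ℤ`, a nonzero element survives in a finite quotient. -/
theorem exists_ideal_finite_quotient_notMem {A : Type*} [CommRing A] [IsDomain A]
    [Algebra.FiniteType ℤ A] {a : A} (ha : a ≠ 0) :
    ∃ I : Ideal A, Finite (A ⧸ I) ∧ a ∉ I := by
  let B := Localization.Away a
  have : Nontrivial B := (IsLocalization.injective B
    (powers_le_nonZeroDivisors_of_noZeroDivisors ha)).nontrivial
  have hB : Algebra.FiniteType ℤ B :=
    Algebra.FiniteType.trans (S := A) inferInstance inferInstance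
  obtain ⟨m, hm⟩ := Ideal.exists_maximal B
  let := Ideal.Quotient.field m
  have : Finite (B ⧸ m) := finite_of_finiteType_int (B ⧸ m)
  refine ⟨m.comap (algebraMap A B), ?_, fun h => ?_⟩
  · exact Finite.of_injective _ (Ideal.quotientMap_injective (I := m) (f := algebraMap A B))
  · exact hm.ne_top (Ideal.eq_top_of_isUnit_mem m h (IsLocalization.Away.algebraMap_isUnit a))

end FiniteType

section Torsion

open Polynomial

theorem Multiset.re_sum_le_card {s : Multiset ℂ} (hs : ∀ x ∈ s, ‖x‖ ≤ 1) :
    s.sum.re ≤ Multiset.card s := by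
  induction s using Multiset.induction with
  | empty => simp
  | cons a s ih =>
    have h1 := ih fun x hx => hs x (Multiset.mem_cons_of_mem hx)
    have h2 := (Complex.re_le_norm a).trans (hs a (Multiset.mem_cons_self a s))
    simp only [Multiset.sum_cons, Complex.add_re, Multiset.card_cons, Nat.cast_add, Nat.cast_one]
    linarith

theorem Multiset.eq_one_of_sum_eq_card {s : Multiset ℂ} (hs : ∀ x ∈ s, ‖x‖ ≤ 1)
    (hsum : s.sum = Multiset.card s) {a : ℂ} (ha : a ∈ s) : a = 1 := by
  have hnorm := hs a ha
  obtain ⟨t, rfl⟩ := Multiset.exists_cons_of_mem ha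
  have ht := Multiset.re_sum_le_card fun x hx => hs x (Multiset.mem_cons_of_mem hx)
  have hre := congrArg Complex.re hsum
  simp only [Multiset.sum_cons, Complex.add_re, Multiset.card_cons, Nat.cast_add, Nat.cast_one,
    Complex.natCast_re, Complex.one_re] at hre
  have ha1 : 1 ≤ a.re := by linarith
  have hsq : a.re * a.re + a.im * a.im ≤ 1 := by
    rw [← Complex.normSq_apply, Complex.normSq_eq_norm_sq]
    nlinarith [norm_nonneg a]
  apply Complex.ext
  · simp only [Complex.one_re]
    nlinarith [mul_self_nonneg a.im]
  · simp only [Complex.one_im]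
    nlinarith [mul_self_nonneg a.im]

namespace Matrix

variable {n : Type*} [Fintype n] [DecidableEq n]

theorem pow_eq_one_of_mem_roots_charpoly {K : Type*} [Field K] {g : Matrix n n K} {k : ℕ}
    (hg : g ^ k = 1) {μ : K} (hμ : μ ∈ g.charpoly.roots) : μ ^ k = 1 := by
  have hspec : μ ∈ spectrum K g := mem_spectrum_of_isRoot_charpoly (isRoot_of_mem_roots hμ)
  have : Nonempty n := by
    by_contra hempty
    rw [not_nonempty_iff] at hempty
    simp [charpoly_isEmpty] at hμ
  have h := spectrum.pow_mem_pow g k hspec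
  rw [hg, spectrum.one_eq] at h
  exact h

theorem card_roots_charpoly {K : Type*} [Field K] [IsAlgClosed K] (g : Matrix n n K) :
    Multiset.card g.charpoly.roots = Fintype.card n := by
  rw [← (IsAlgClosed.splits g.charpoly).natDegree_eq_card_roots, charpoly_natDegree_eq_dim]

theorem eq_one_of_pow_eq_one_of_trace_eq_card {g : Matrix n n ℂ} {k : ℕ} (hk : 0 < k)
    (hg : g ^ k = 1) (htr : g.trace = Fintype.card n) : g = 1 := by
  have hroots : ∀ μ ∈ g.charpoly.roots, μ = 1 := fun μ hμ =>
    Multiset.eq_one_of_sum_eq_card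
      (fun x hx => (Complex.norm_eq_one_of_pow_eq_one
        (pow_eq_one_of_mem_roots_charpoly hg hx) hk.ne').le)
      (by rw [← trace_eq_sum_roots_charpoly, htr, card_roots_charpoly]) hμ
  have hchar : g.charpoly = (X - C 1) ^ Fintype.card n := by
    rw [(IsAlgClosed.splits g.charpoly).eq_prod_roots_of_monic g.charpoly_monic,
      Multiset.eq_replicate.mpr ⟨card_roots_charpoly g, hroots⟩]
    simp
  set q : ℂ[X] := ∑ i ∈ Finset.range k, X ^ i with hq
  have hcop : IsCoprime q (X - C 1) := by
    refine ((irreducible_X_sub_C (1 : ℂ)).coprime_iff_not_dvd.mpr ?_).symm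
    rw [dvd_iff_isRoot, IsRoot.def]
    simp [hq, eval_finsetSum, hk.ne']
  obtain ⟨u, v, huv⟩ := hcop.pow_right (n := Fintype.card n)
  have hgeom : q * (X - 1) = X ^ k - 1 := geom_sum_mul X k
  have hqg : aeval g q * (g - 1) = 0 := by
    simpa [hg] using congrArg (aeval g) hgeom
  have hinv : aeval g u * aeval g q = 1 := by
    have h := congrArg (aeval g) huv
    rw [← hchar] at h
    simpa [aeval_self_charpoly] using h
  refine sub_eq_zero.mp ?_
  calc g - 1 = aeval g u * aeval g q * (g - 1) := by rw [hinv, one_mul]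
    _ = 0 := by rw [mul_assoc, hqg, mul_zero]

theorem finite_trace_of_pow_eq_one {k : ℕ} (hk : 0 < k) :
    {t : ℂ | ∃ g : Matrix n n ℂ, g ^ k = 1 ∧ g.trace = t}.Finite := by
  refine ((((nthRootsFinset k (1 : ℂ)).sym (Fintype.card n)).finite_toSet).image
    fun s : Sym ℂ (Fintype.card n) => (s : Multiset ℂ).sum).subset ?_
  rintro _ ⟨g, hg, rfl⟩
  refine ⟨Sym.mk g.charpoly.roots (card_roots_charpoly g), ?_,
    (trace_eq_sum_roots_charpoly g).symm⟩
  rw [Finset.mem_coe, Finset.mem_sym_iff]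
  exact fun μ hμ => (mem_nthRootsFinset hk 1).mpr (pow_eq_one_of_mem_roots_charpoly hg hμ)

end Matrix

end Torsion

section Linear

open Matrix

/-- A finitely generated linear group is defined over a finitely generated ring. -/
theorem exists_hom_generalLinearGroup_subalgebra {n : Type*} [Fintype n] [DecidableEq n]
    {Γ : Type*} [Group Γ] [Group.FG Γ] (ρ : Γ →* GL n ℂ) :
    ∃ A : Subalgebra ℤ ℂ, Algebra.FiniteType ℤ A ∧ ∃ f : Γ →* GL n A,
      ∀ γ i j, ((f γ i j : A) : ℂ) = ρ γ i j := by
  obtain ⟨S, hS⟩ := Group.FG.out (G := Γ)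
  let E : Set ℂ := ⋃ γ ∈ S, ⋃ i, ⋃ j, {ρ γ i j, ρ γ⁻¹ i j}
  have hE : E.Finite := S.finite_toSet.biUnion fun γ _ =>
    Set.finite_iUnion fun i => Set.finite_iUnion fun j => Set.toFinite _
  let A : Subalgebra ℤ ℂ := Algebra.adjoin ℤ E
  have hA : Algebra.FiniteType ℤ A := Algebra.FiniteType.adjoin_of_finite hE
  have hmem : ∀ γ ∈ S, ∀ i j, ρ γ i j ∈ A ∧ ρ γ⁻¹ i j ∈ A := fun γ hγ i j =>
    ⟨Algebra.subset_adjoin (by simp only [E, Set.mem_iUnion]; exact ⟨γ, hγ, i, j, by simp⟩),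
      Algebra.subset_adjoin (by simp only [E, Set.mem_iUnion]; exact ⟨γ, hγ, i, j, by simp⟩)⟩
  let ι : GL n A →* GL n ℂ := GeneralLinearGroup.map (A.val : A →+* ℂ)
  have hmap : Function.Injective ((A.val : A →+* ℂ).mapMatrix (m := n)) :=
    Matrix.map_injective Subtype.val_injective
  have hι : Function.Injective ι := Units.map_injective hmap
  have hrange : ∀ γ, ρ γ ∈ ι.range := by
    have hle : (Subgroup.closure (S : Set Γ)) ≤ ι.range.comap ρ := by
      rw [Subgroup.closure_le]
      intro γ hγ
      let a : Matrix n n A := Matrix.of fun i j => ⟨ρ γ i j, (hmem γ hγ i j).1⟩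
      let b : Matrix n n A := Matrix.of fun i j => ⟨ρ γ⁻¹ i j, (hmem γ hγ i j).2⟩
      have ha : (A.val : A →+* ℂ).mapMatrix a = (ρ γ : Matrix n n ℂ) := by ext; rfl
      have hb : (A.val : A →+* ℂ).mapMatrix b = (ρ γ⁻¹ : Matrix n n ℂ) := by ext; rfl
      have hab : a * b = 1 := hmap (by
        rw [map_mul, ha, hb, map_one, ← Units.val_mul, ← map_mul]; simp)
      have hba : b * a = 1 := hmap (by
        rw [map_mul, ha, hb, map_one, ← Units.val_mul, ← map_mul]; simp)
      exact ⟨⟨a, b, hab, hba⟩, Units.ext ha⟩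
    rw [hS] at hle
    exact fun γ => hle (Subgroup.mem_top γ)
  let f : Γ →* GL n A :=
    (MonoidHom.ofInjective hι).symm.toMonoidHom.comp (ρ.codRestrict ι.range hrange)
  refine ⟨A, hA, f, fun γ i j => ?_⟩
  have hf : ι (f γ) = ρ γ :=
    congrArg Subtype.val ((MonoidHom.ofInjective hι).apply_symm_apply ⟨ρ γ, hrange γ⟩)
  rw [← hf]
  rfl

/-- The entries of the elements of the congruence subgroup of a finite quotient are congruent to
those of the identity. -/
theorem exists_congruence_subgroup {n : Type*} [Fintype n] [DecidableEq n] {A : Type*}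
    [CommRing A] {Γ : Type*} [Group Γ] (f : Γ →* GL n A) (I : Ideal A) [Finite (A ⧸ I)] :
    ∃ N : Subgroup Γ, N.Normal ∧ N.FiniteIndex ∧
      ∀ γ ∈ N, ∀ i j, f γ i j - (1 : Matrix n n A) i j ∈ I := by
  let φ : Γ →* GL n (A ⧸ I) := (GeneralLinearGroup.map (Ideal.Quotient.mk I)).comp f
  have : Finite (GL n (A ⧸ I)) := inferInstanceAs (Finite (Matrix n n (A ⧸ I))ˣ)
  refine ⟨φ.ker, inferInstance, inferInstance, fun γ hγ i j => ?_⟩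
  have h : φ γ i j = (1 : GL n (A ⧸ I)) i j := by rw [MonoidHom.mem_ker.mp hγ]
  rw [← Ideal.Quotient.eq]
  refine Eq.trans h ?_
  by_cases hij : i = j <;> simp [Matrix.one_apply, hij]

/-- **Malcev's theorem** over the complex numbers. -/
theorem residuallyFinite_of_injective_generalLinearGroup {n : Type*} [Fintype n] [DecidableEq n]
    {Γ : Type*} [Group Γ] [Group.FG Γ] {ρ : Γ →* GL n ℂ} (hρ : Function.Injective ρ) :
    ResiduallyFinite Γ := by
  intro g hg
  obtain ⟨A, hA, f, hf⟩ := exists_hom_generalLinearGroup_subalgebra ρ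
  obtain ⟨i, j, hij⟩ : ∃ i j, f g i j - (1 : Matrix n n A) i j ≠ 0 := by
    by_contra! h
    refine hg (hρ ?_)
    rw [map_one]
    ext i j
    rw [← hf, sub_eq_zero.mp (h i j)]
    by_cases hij : i = j <;> simp [Matrix.one_apply, hij]
  obtain ⟨I, hI, hnotMem⟩ := exists_ideal_finite_quotient_notMem hij
  obtain ⟨N, hN, hfin, hcong⟩ := exists_congruence_subgroup f I
  exact ⟨N, hN, hfin, fun h => hnotMem (hcong g h i j)⟩

/-- **Selberg's lemma** for torsion of a fixed exponent. -/
theorem exists_normal_finiteIndex_no_torsion {n : Type*} [Fintype n] [DecidableEq n]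
    {Γ : Type*} [Group Γ] [Group.FG Γ] {ρ : Γ →* GL n ℂ} (hρ : Function.Injective ρ)
    {k : ℕ} (hk : 0 < k) :
    ∃ N : Subgroup Γ, N.Normal ∧ N.FiniteIndex ∧ ∀ g ∈ N, g ^ k = 1 → g = 1 := by
  obtain ⟨A, hA, f, hf⟩ := exists_hom_generalLinearGroup_subalgebra ρ
  let τ : Γ → A := fun γ => (f γ : Matrix n n A).trace - (1 : Matrix n n A).trace
  have hτ : ∀ γ, (τ γ : ℂ) = (ρ γ : Matrix n n ℂ).trace - Fintype.card n := by
    intro γ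
    simp [τ, Matrix.trace, hf]
  have hρk : ∀ γ, γ ^ k = 1 → (ρ γ : Matrix n n ℂ) ^ k = 1 := by
    intro γ hγ
    rw [← Units.val_pow_eq_pow_val, ← map_pow, hγ, map_one, Units.val_one]
  have hS : (τ '' {γ | γ ^ k = 1 ∧ γ ≠ 1}).Finite := by
    refine Set.Finite.of_finite_image (f := Subtype.val) ?_ Subtype.val_injective.injOn
    refine ((Matrix.finite_trace_of_pow_eq_one (n := n) hk).image
      fun t => t - (Fintype.card n : ℂ)).subset ?_
    rintro _ ⟨_, ⟨γ, ⟨hγ, -⟩, rfl⟩, rfl⟩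
    exact ⟨_, ⟨ρ γ, hρk γ hγ, rfl⟩, (hτ γ).symm⟩
  have hne : ∏ a ∈ hS.toFinset, a ≠ 0 := by
    rw [Finset.prod_ne_zero_iff]
    intro a ha
    obtain ⟨γ, ⟨hγ, hγ1⟩, rfl⟩ := hS.mem_toFinset.mp ha
    intro h0
    have h := hτ γ
    rw [h0, ZeroMemClass.coe_zero, eq_comm, sub_eq_zero] at h
    refine hγ1 (hρ ?_)
    rw [map_one]
    exact Units.ext (Matrix.eq_one_of_pow_eq_one_of_trace_eq_card hk (hρk γ hγ) h)
  obtain ⟨I, hI, hnotMem⟩ := exists_ideal_finite_quotient_notMem hne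
  obtain ⟨N, hN, hfin, hcong⟩ := exists_congruence_subgroup f I
  refine ⟨N, hN, hfin, fun g hg hgk => ?_⟩
  by_contra hg1
  refine hnotMem (I.mem_of_dvd (Finset.dvd_prod_of_mem _
    (hS.mem_toFinset.mpr ⟨g, ⟨hgk, hg1⟩, rfl⟩)) ?_)
  simp only [τ, Matrix.trace, Matrix.diag_apply, ← Finset.sum_sub_distrib]
  exact I.sum_mem fun i _ => hcong g hg i i

end Linear

/-- For an infinite finitely generated linear group `Γ ≤ GL_m(ℂ)`
with finite generating set `X`, and `k > 0`, one has `F_{Γ,X} ≈ F^k_{Γ,X}`. -/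
theorem farbF_equiv_farbFk (m : ℕ) (Γ : Subgroup (Matrix.GeneralLinearGroup (Fin m) ℂ))
    (hinf : Infinite Γ) (hfg : Group.FG Γ)
    (X : Finset Γ) (hX : Subgroup.closure (X : Set Γ) = ⊤)
    (k : ℕ) (hk : 0 < k) :
    FarbEquiv (farbF (X : Set Γ)) (farbFk k (X : Set Γ)) := by
  have hG : ResiduallyFinite Γ :=
    residuallyFinite_of_injective_generalLinearGroup Γ.subtype_injective
  obtain ⟨N, hN, hfin, htors⟩ :=
    exists_normal_finiteIndex_no_torsion Γ.subtype_injective hk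
  exact ⟨farbF_preceq_farbFk hG hX X.finite_toSet hN hfin htors,
    farbFk_preceq_farbF hX X.finite_toSet hk⟩
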